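/- Let N ≥ 0 and α, β, γ ∈ ℝ with α + β + k ≠ 0 for k = 1, 2, …, 2N+2, and set δ = −N − β − 1 (i.e. β + δ + 1 = −N). For 0 ≤ n ≤ N define a_n = (n+α+1)(n+α+β+1)(n+γ+1)(N−n) / [(2n+α+β+1)(2n+α+β+2)] and c_n = −n(n+α+β+N+1)(n+α+β−γ)(n+β) / [(2n+α+β)(2n+α+β+1)] (so a_N = 0 and c_0 = 0). Let ℛ𝒜_{N+1} be the (N+1)×(N+1) tridiagonal matrix with diagonal entries a_n + c_n, superdiagonal entries a_n, and subdiagonal entries c_n. Then for every real λ, det(λ·I_{N+1} + ℛ𝒜_{N+1}) = ∏_{n=0}^{N} (λ + n(n+γ+δ+1)). Equivalently, with λ(x) = −x(x+γ+δ+1), the Racah determinant equals (−x)_{N+1}(x+γ+δ+1)_{N+1}. -/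

import Mathlib

/-- The Racah superdiagonal recurrence coefficient
`a_n = (n+α+1)(n+α+β+1)(n+γ+1)(N-n) / [(2n+α+β+1)(2n+α+β+2)]`. -/
noncomputable def racahA (α β γ : ℝ) (N n : ℕ) : ℝ :=
  ((n : ℝ) + α + 1) * ((n : ℝ) + α + β + 1) * ((n : ℝ) + γ + 1) * ((N : ℝ) - (n : ℝ)) /
    ((2 * (n : ℝ) + α + β + 1) * (2 * (n : ℝ) + α + β + 2))

/-- The Racah subdiagonal recurrence coefficient
`c_n = -n(n+α+β+N+1)(n+α+β-γ)(n+β) / [(2n+α+β)(2n+α+β+1)]`. -/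
noncomputable def racahC (α β γ : ℝ) (N n : ℕ) : ℝ :=
  -(n : ℝ) * ((n : ℝ) + α + β + (N : ℝ) + 1) * ((n : ℝ) + α + β - γ) * ((n : ℝ) + β) /
    ((2 * (n : ℝ) + α + β) * (2 * (n : ℝ) + α + β + 1))

/-- The Racah tridiagonal 'ansatz' matrix `ℛ𝒜_{N+1}` with superdiagonal `a_n`,
subdiagonal `c_n`, and diagonal `a_n + c_n` (0-indexed, size `N + 1`). -/
noncomputable def racahM (α β γ : ℝ) (N : ℕ) : Matrix (Fin (N + 1)) (Fin (N + 1)) ℝ :=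
  Matrix.of fun i j =>
    if (j : ℕ) = (i : ℕ) + 1 then racahA α β γ N i
    else if (i : ℕ) = (j : ℕ) + 1 then racahC α β γ N i
    else if i = j then racahA α β γ N i + racahC α β γ N i
    else 0

/-- The left factor of the factorisation of `racahM α β γ (N + 1)`. -/
noncomputable def racahLeft (α β γ : ℝ) (N : ℕ) : Matrix (Fin (N + 2)) (Fin (N + 1)) ℝ :=
  Matrix.of fun i k =>
    ((if (i : ℕ) = k then racahA α β γ (N + 1) i else 0) +
      if (i : ℕ) = k + 1 then racahC α β γ (N + 1) i else 0) * (2 * ((k : ℕ) : ℝ) + α + β + 2)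

/-- The right factor of the factorisation of `racahM α β γ (N + 1)`. -/
noncomputable def racahRight (α β : ℝ) (N : ℕ) : Matrix (Fin (N + 1)) (Fin (N + 2)) ℝ :=
  Matrix.of fun k j =>
    ((if j = k.castSucc then 1 else 0) + if j = k.succ then 1 else 0) *
      (2 * ((k : ℕ) : ℝ) + α + β + 2)⁻¹

lemma racahLeft_mul_racahRight (α β γ : ℝ) (N : ℕ)
    (h : ∀ k : ℕ, k ≤ N → 2 * (k : ℝ) + α + β + 2 ≠ 0) :
    racahLeft α β γ N * racahRight α β N = racahM α β γ (N + 1) := by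
  ext ⟨i, hi⟩ ⟨j, hj⟩
  have hterm : ∀ k : Fin (N + 1),
      racahLeft α β γ N ⟨i, hi⟩ k * racahRight α β N k ⟨j, hj⟩ =
        ((if i = (k : ℕ) then racahA α β γ (N + 1) i else 0) +
          if i = (k : ℕ) + 1 then racahC α β γ (N + 1) i else 0) *
        ((if j = (k : ℕ) then 1 else 0) + if j = (k : ℕ) + 1 then 1 else 0) := by
    intro k
    have hk := h k (by omega)
    simp only [racahLeft, racahRight, Matrix.of_apply, Fin.ext_iff, Fin.val_castSucc, Fin.val_succ]
    field_simp
  rw [Matrix.mul_apply, Finset.sum_congr rfl fun k _ => hterm k,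
    Fin.sum_univ_eq_sum_range (fun k => ((if i = k then racahA α β γ (N + 1) i else 0) +
          if i = k + 1 then racahC α β γ (N + 1) i else 0) *
        ((if j = k then 1 else 0) + if j = k + 1 then 1 else 0)) (N + 1)]
  simp only [add_mul, Finset.sum_add_distrib, ite_mul, zero_mul, Finset.sum_ite_eq,
    Finset.mem_range, racahM, Matrix.of_apply, Fin.mk.injEq]
  have hA : ¬ i < N + 1 → racahA α β γ (N + 1) i = 0 := by
    intro hlt
    obtain rfl : i = N + 1 := by omega
    simp [racahA]
  cases i with
  | zero =>
    simp [racahC]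
    grind
  | succ i =>
    simp only [Nat.add_right_cancel_iff, Finset.sum_ite_eq, Finset.mem_range]
    grind

lemma racahRight_mul_racahLeft (α β γ : ℝ) (N : ℕ)
    (h : ∀ k : ℕ, 1 ≤ k → k ≤ 2 * (N + 1) + 2 → α + β + (k : ℝ) ≠ 0) :
    racahRight α β N * racahLeft α β γ N =
      (γ - β - N) • (1 : Matrix (Fin (N + 1)) (Fin (N + 1)) ℝ) +
        racahM (α + 1) β (γ + 1) N := by
  ext k l
  simp only [Matrix.mul_apply, racahRight, Matrix.of_apply, add_mul, ite_mul, one_mul, zero_mul,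
    Finset.sum_add_distrib, Finset.sum_ite_eq', Finset.mem_univ, if_true]
  obtain ⟨k, hk⟩ := k
  obtain ⟨l, hl⟩ := l
  simp only [racahLeft, racahM, Matrix.of_apply, Matrix.add_apply, Matrix.smul_apply,
    Matrix.one_apply, Fin.val_castSucc, Fin.val_succ, Fin.mk.injEq, smul_eq_mul]
  have hne : ∀ (n c : ℕ) (t : ℝ), 1 ≤ 2 * n + c → 2 * n + c ≤ 2 * (N + 1) + 2 →
      t = α + β + (2 * n + c) → t ≠ 0 := by
    rintro n c t h1 h2 rfl
    exact_mod_cast h (2 * n + c) h1 h2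
  rcases lt_trichotomy k l with hkl | rfl | hkl
  · by_cases hl' : l = k + 1
    · subst hl'
      have e2 : 2 * (k : ℝ) + α + β + 2 ≠ 0 := hne k 2 _ (by omega) (by omega) (by push_cast; ring)
      have e3 : 2 * (k : ℝ) + α + β + 3 ≠ 0 := hne k 3 _ (by omega) (by omega) (by push_cast; ring)
      have e4 : 2 * (k : ℝ) + α + β + 4 ≠ 0 := hne k 4 _ (by omega) (by omega) (by push_cast; ring)
      simp [racahA, show ¬ k = k + 1 + 1 by omega,
        show 2 * ((k : ℝ) + 1) + α + β + 1 = 2 * (k : ℝ) + α + β + 3 by ring,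
        show 2 * ((k : ℝ) + 1) + α + β + 2 = 2 * (k : ℝ) + α + β + 4 by ring,
        show 2 * (k : ℝ) + (α + 1) + β + 1 = 2 * (k : ℝ) + α + β + 2 by ring,
        show 2 * (k : ℝ) + (α + 1) + β + 2 = 2 * (k : ℝ) + α + β + 3 by ring]
      field_simp
      ring
    · simp [hl', hkl.ne, show ¬ k = l + 1 by omega, show ¬ k + 1 = l by omega]
  · have e1 : 2 * (k : ℝ) + α + β + 1 ≠ 0 := hne k 1 _ (by omega) (by omega) (by push_cast; ring)
    have e2 : 2 * (k : ℝ) + α + β + 2 ≠ 0 := hne k 2 _ (by omega) (by omega) (by push_cast; ring)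
    have e3 : 2 * (k : ℝ) + α + β + 3 ≠ 0 := hne k 3 _ (by omega) (by omega) (by push_cast; ring)
    simp [racahA, racahC,
        show 2 * ((k : ℝ) + 1) + α + β = 2 * (k : ℝ) + α + β + 2 by ring,
        show 2 * (k : ℝ) + α + β + 2 + 1 = 2 * (k : ℝ) + α + β + 3 by ring,
        show 2 * (k : ℝ) + (α + 1) + β = 2 * (k : ℝ) + α + β + 1 by ring,
        show 2 * (k : ℝ) + α + β + 1 + 1 = 2 * (k : ℝ) + α + β + 2 by ring,
        show 2 * (k : ℝ) + α + β + 1 + 2 = 2 * (k : ℝ) + α + β + 3 by ring]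
    field_simp
    ring
  · by_cases hl' : k = l + 1
    · subst hl'
      have e2 : 2 * (l : ℝ) + α + β + 2 ≠ 0 := hne l 2 _ (by omega) (by omega) (by push_cast; ring)
      have e3 : 2 * (l : ℝ) + α + β + 3 ≠ 0 := hne l 3 _ (by omega) (by omega) (by push_cast; ring)
      have e4 : 2 * (l : ℝ) + α + β + 4 ≠ 0 := hne l 4 _ (by omega) (by omega) (by push_cast; ring)
      simp [racahC, show ¬ l + 1 + 1 = l by omega, show ¬ l = l + 1 + 1 by omega,
        show 2 * ((l : ℝ) + 1) + α + β = 2 * (l : ℝ) + α + β + 2 by ring,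
        show 2 * (l : ℝ) + α + β + 2 + 1 = 2 * (l : ℝ) + α + β + 3 by ring,
        show 2 * (l : ℝ) + α + β + 2 + 2 = 2 * (l : ℝ) + α + β + 4 by ring,
        show 2 * ((l : ℝ) + 1) + (α + 1) + β = 2 * (l : ℝ) + α + β + 3 by ring,
        show 2 * (l : ℝ) + α + β + 3 + 1 = 2 * (l : ℝ) + α + β + 4 by ring]
      field_simp
      ring
    · simp [hl', hkl.ne', show ¬ l = k + 1 by omega, show ¬ k + 1 = l by omega]

lemma det_smul_one_add_mul_comm {N : ℕ} (B : Matrix (Fin (N + 1)) (Fin N) ℝ)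
    (E : Matrix (Fin N) (Fin (N + 1)) ℝ) (lam : ℝ) :
    (lam • (1 : Matrix (Fin (N + 1)) (Fin (N + 1)) ℝ) + B * E).det =
      lam * (lam • (1 : Matrix (Fin N) (Fin N) ℝ) + E * B).det := by
  have h := congrArg (Polynomial.eval lam)
    (Matrix.charpoly_mul_comm_of_le (A := -B) (B := E) (by simp))
  simpa [Matrix.eval_charpoly, ← Matrix.smul_one_eq_diagonal] using h

lemma det_racahM (N : ℕ) (α β γ lam : ℝ)
    (h : ∀ k : ℕ, 1 ≤ k → k ≤ 2 * N + 2 → α + β + (k : ℝ) ≠ 0) :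
    (lam • (1 : Matrix (Fin (N + 1)) (Fin (N + 1)) ℝ) + racahM α β γ N).det =
      ∏ n ∈ Finset.range (N + 1), (lam + (n : ℝ) * ((n : ℝ) + γ - β - N)) := by
  induction N generalizing α γ lam with
  | zero => simp [racahM, racahA, racahC]
  | succ N ih =>
    have h' : ∀ k : ℕ, k ≤ N → 2 * (k : ℝ) + α + β + 2 ≠ 0 := by
      intro k hk
      convert h (2 * k + 2) (by omega) (by omega) using 1
      push_cast
      ring
    rw [← racahLeft_mul_racahRight α β γ N h', det_smul_one_add_mul_comm,
      racahRight_mul_racahLeft α β γ N h, ← add_assoc, ← add_smul,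
      ih (α + 1) (γ + 1) (lam + (γ - β - N)), Finset.prod_range_succ' _ (N + 1), mul_comm]
    · congr 1
      · refine Finset.prod_congr rfl fun n _ => ?_
        push_cast
        ring
      · simp
    · intro k hk hk'
      convert h (k + 1) (by omega) (by omega) using 1
      push_cast
      ring

theorem racah_det (N : ℕ) (α β γ δ : ℝ) (hδ : δ = -(N : ℝ) - β - 1)
    (hab : ∀ k : ℕ, 1 ≤ k → k ≤ 2 * N + 2 → α + β + (k : ℝ) ≠ 0) :
    (∀ lam : ℝ,
      (lam • (1 : Matrix (Fin (N + 1)) (Fin (N + 1)) ℝ) + racahM α β γ N).det =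
        ∏ n ∈ Finset.range (N + 1), (lam + (n : ℝ) * ((n : ℝ) + γ + δ + 1))) ∧
    (∀ x : ℝ,
      ((-x * (x + γ + δ + 1)) • (1 : Matrix (Fin (N + 1)) (Fin (N + 1)) ℝ) + racahM α β γ N).det =
        (∏ j ∈ Finset.range (N + 1), ((j : ℝ) - x)) *
          ∏ j ∈ Finset.range (N + 1), (x + γ + δ + 1 + (j : ℝ))) := by
  subst hδ
  have key : ∀ lam : ℝ,
      (lam • (1 : Matrix (Fin (N + 1)) (Fin (N + 1)) ℝ) + racahM α β γ N).det =
        ∏ n ∈ Finset.range (N + 1),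
          (lam + (n : ℝ) * ((n : ℝ) + γ + (-(N : ℝ) - β - 1) + 1)) := by
    intro lam
    rw [det_racahM N α β γ lam hab]
    exact Finset.prod_congr rfl fun n _ => by ring
  refine ⟨key, fun x => ?_⟩
  rw [key, ← Finset.prod_mul_distrib]
  exact Finset.prod_congr rfl fun n _ => by ring
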